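/- Let G be a snake graph. For any two perfect matchings P and Q of G, there exists a finite sequence of tile indices i_1, …, i_r such that, setting Q_0 = P and Q_t = μ_{i_t} Q_{t−1}, each Q_{t−1} can twist on G_{i_t} and Q_r = Q; that is, Q can be obtained from P by a sequence of twists. -/

import Mathlib

/-- An edge of the integer lattice: `(p, true)` is the horizontal unit segment
from `p` to `p + (1, 0)`, and `(p, false)` is the vertical unit segment from
`p` to `p + (0, 1)`. -/
abbrev LatticeEdge : Type := (ℤ × ℤ) × Bool

/-- A lattice edge is horizontal if it is parallel to the x-axis. -/
def IsHorizontalEdge (e : LatticeEdge) : Prop := e.2 = true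

/-- A lattice edge is vertical if it is parallel to the y-axis. -/
def IsVerticalEdge (e : LatticeEdge) : Prop := e.2 = false

/-- The two endpoints of a lattice edge. -/
def endpointsOf (e : LatticeEdge) : Set (ℤ × ℤ) :=
  if e.2 then {e.1, (e.1.1 + 1, e.1.2)} else {e.1, (e.1.1, e.1.2 + 1)}

/-- The south side of the unit tile with lower-left corner `c`. -/
def southSide (c : ℤ × ℤ) : LatticeEdge := (c, true)

/-- The north side of the unit tile with lower-left corner `c`. -/
def northSide (c : ℤ × ℤ) : LatticeEdge := ((c.1, c.2 + 1), true)

/-- The west side of the unit tile with lower-left corner `c`. -/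
def westSide (c : ℤ × ℤ) : LatticeEdge := (c, false)

/-- The east side of the unit tile with lower-left corner `c`. -/
def eastSide (c : ℤ × ℤ) : LatticeEdge := ((c.1 + 1, c.2), false)

/-- The four sides of the unit tile with lower-left corner `c`. -/
def tileSides (c : ℤ × ℤ) : Set LatticeEdge :=
  {southSide c, northSide c, westSide c, eastSide c}

/-- The four corners of the unit tile with lower-left corner `c`. -/
def tileCorners (c : ℤ × ℤ) : Set (ℤ × ℤ) :=
  {c, (c.1 + 1, c.2), (c.1, c.2 + 1), (c.1 + 1, c.2 + 1)}

/-- A snake graph with `d ≥ 1` tiles: tile `1` has lower-left corner `(0, 0)`,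
and each subsequent tile is the translate of the previous one by one unit to
the right or one unit up.  Tiles are indexed `1, …, d`; `corner i` is the
lower-left corner of tile `i`. -/
structure SnakeGraph where
  d : ℕ
  one_le_d : 1 ≤ d
  corner : ℕ → ℤ × ℤ
  corner_one : corner 1 = (0, 0)
  corner_succ : ∀ i, 1 ≤ i → i < d →
    corner (i + 1) = ((corner i).1 + 1, (corner i).2) ∨
      corner (i + 1) = ((corner i).1, (corner i).2 + 1)

namespace SnakeGraph

/-- The set of sides of tile `i` of `G`. -/
def tile (G : SnakeGraph) (i : ℕ) : Set LatticeEdge := tileSides (G.corner i)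

/-- The edge set of (the graph of) `G`: all sides of all tiles. -/
def edges (G : SnakeGraph) : Set LatticeEdge := ⋃ i ∈ Set.Icc 1 G.d, G.tile i

/-- The vertex set of `G`: all corners of all tiles. -/
def vertices (G : SnakeGraph) : Set (ℤ × ℤ) :=
  ⋃ i ∈ Set.Icc 1 G.d, tileCorners (G.corner i)

/-- A perfect matching of `G`: a set of edges of `G` such that every vertex of
`G` is incident to exactly one edge of the set. -/
def IsPerfectMatching (G : SnakeGraph) (P : Set LatticeEdge) : Prop :=
  P ⊆ G.edges ∧ ∀ v ∈ G.vertices, ∃! e, e ∈ P ∧ v ∈ endpointsOf e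

/-- `P` can twist on tile `i` if two of the four sides of tile `i` belong to `P`. -/
def CanTwist (G : SnakeGraph) (P : Set LatticeEdge) (i : ℕ) : Prop :=
  1 ≤ i ∧ i ≤ G.d ∧ (P ∩ G.tile i).ncard = 2

/-- The twist of `P` on tile `i`: replace the sides of tile `i` belonging to
`P` by the other sides of tile `i`. -/
def twist (G : SnakeGraph) (i : ℕ) (P : Set LatticeEdge) : Set LatticeEdge :=
  (P \ G.tile i) ∪ (G.tile i \ P)

/-- A boundary edge of `G`: an edge which is a side of exactly one tile. -/
def IsBoundaryEdge (G : SnakeGraph) (e : LatticeEdge) : Prop :=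
  ∃! i, (1 ≤ i ∧ i ≤ G.d) ∧ e ∈ G.tile i

/-- `P` is the minimal matching `P₋` of `G`: the perfect matching consisting
only of boundary edges which contains no vertical side of tile `1`. -/
def IsMinimalMatching (G : SnakeGraph) (P : Set LatticeEdge) : Prop :=
  G.IsPerfectMatching P ∧ (∀ e ∈ P, G.IsBoundaryEdge e) ∧
    ∀ e ∈ P ∩ G.tile 1, IsHorizontalEdge e

/-- `P` is the maximal matching `P₊` of `G`: the perfect matching consisting
only of boundary edges other than the minimal one, i.e. the one containing a
vertical side of tile `1`. -/
def IsMaximalMatching (G : SnakeGraph) (P : Set LatticeEdge) : Prop :=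
  G.IsPerfectMatching P ∧ (∀ e ∈ P, G.IsBoundaryEdge e) ∧
    ∃ e ∈ P ∩ G.tile 1, IsVerticalEdge e

/-- `G` is a straight snake graph: every tile is the translate of the previous
one by one unit to the right. -/
def IsStraight (G : SnakeGraph) : Prop :=
  ∀ i, 1 ≤ i → i < G.d → G.corner (i + 1) = ((G.corner i).1 + 1, (G.corner i).2)

end SnakeGraph

namespace TwistAux

/-- `P` is a perfect matching of the graph with edges `E` and vertices `V`. -/
def PM (E : Set LatticeEdge) (V : Set (ℤ × ℤ)) (P : Set LatticeEdge) : Prop :=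
  P ⊆ E ∧ ∀ v ∈ V, ∃! e, e ∈ P ∧ v ∈ endpointsOf e

/-- Twisting on one of the first `n` tiles. -/
def Step (G : SnakeGraph) (n : ℕ) (P Q : Set LatticeEdge) : Prop :=
  ∃ i, 1 ≤ i ∧ i ≤ n ∧ (P ∩ G.tile i).ncard = 2 ∧ Q = G.twist i P

/-- Edges of the first `n` tiles, with the west side of the first tile. -/
def EE (G : SnakeGraph) (n : ℕ) : Set LatticeEdge :=
  {e | e = westSide (G.corner 1) ∨ ∃ i, 1 ≤ i ∧ i ≤ n ∧ e ∈ G.tile i}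

/-- Vertices of the first `n` tiles, with the ends of the west side of the first tile. -/
def VV (G : SnakeGraph) (n : ℕ) : Set (ℤ × ℤ) :=
  {v | v ∈ endpointsOf (westSide (G.corner 1)) ∨
    ∃ i, 1 ≤ i ∧ i ≤ n ∧ v ∈ tileCorners (G.corner i)}

lemma ends_tile {c : ℤ × ℤ} {e : LatticeEdge} (he : e ∈ tileSides c) {v : ℤ × ℤ}
    (hv : v ∈ endpointsOf e) : v ∈ tileCorners c := by
  simp only [tileSides, southSide, northSide, westSide, eastSide, Set.mem_insert_iff,
    Set.mem_singleton_iff] at he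
  rcases he with rfl | rfl | rfl | rfl <;> simp [endpointsOf, tileCorners] at hv ⊢ <;> tauto

lemma ends_EE {G : SnakeGraph} {n : ℕ} {e : LatticeEdge} (he : e ∈ EE G n) {v : ℤ × ℤ}
    (hv : v ∈ endpointsOf e) : v ∈ VV G n := by
  rcases he with rfl | ⟨i, h1, h2, h3⟩
  · exact Or.inl hv
  · exact Or.inr ⟨i, h1, h2, ends_tile h3 hv⟩

lemma tile_ncard (c : ℤ × ℤ) : (tileSides c).ncard = 4 := by
  have : tileSides c = (({southSide c, northSide c, westSide c, eastSide c} :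
      Finset LatticeEdge) : Set LatticeEdge) := by simp [tileSides]
  rw [this, Set.ncard_coe_finset]
  obtain ⟨x, y⟩ := c
  simp [southSide, northSide, westSide, eastSide, Finset.card_insert_of_notMem]

lemma step_symm {G : SnakeGraph} {n : ℕ} {P Q : Set LatticeEdge} (h : Step G n P Q) :
    Step G n Q P := by
  obtain ⟨i, h1, h2, h3, rfl⟩ := h
  refine ⟨i, h1, h2, ?_, ?_⟩
  · have e : G.twist i P ∩ G.tile i = G.tile i \ (P ∩ G.tile i) := by
      ext x; simp [SnakeGraph.twist]; tauto
    have fin : (G.tile i).Finite := by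
      apply Set.finite_of_ncard_ne_zero; unfold SnakeGraph.tile; rw [tile_ncard]; decide
    rw [e, Set.ncard_sdiff Set.inter_subset_right (fin.subset Set.inter_subset_right), h3]
    unfold SnakeGraph.tile; rw [tile_ncard]
  · ext x; by_cases hx : x ∈ P <;> by_cases hy : x ∈ G.tile i <;> simp [SnakeGraph.twist, hx, hy]

/-- Gluing data: tile `T` with sides `e f g h` is glued to `(E, V)` along `e`. -/
structure Glue (E : Set LatticeEdge) (V : Set (ℤ × ℤ)) (T : Set LatticeEdge)
    (e f g h : LatticeEdge) (a b a' b' : ℤ × ℤ) : Prop where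
  hT : T = {e, f, g, h}
  hgh : g ≠ h
  heE : e ∈ E
  he : endpointsOf e = {a, b}
  hf : endpointsOf f = {a', b'}
  hg : endpointsOf g = {a, a'}
  hh : endpointsOf h = {b, b'}
  ha' : a' ∉ V
  hb' : b' ∉ V
  hEV : ∀ x ∈ E, ∀ v ∈ endpointsOf x, v ∈ V
  hab : a' ≠ b'

lemma glue_cases {E V T e f g h a b a' b'} (D : Glue E V T e f g h a b a' b')
    {P : Set LatticeEdge} (hP : PM (E ∪ T) (V ∪ {a, b, a', b'}) P) :
    (f ∈ P ∧ PM E V (P \ {f})) ∨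
    (g ∈ P ∧ h ∈ P ∧ e ∉ P ∧ f ∉ P ∧ PM E V ((P \ {g, h}) ∪ {e})) := by
  obtain ⟨hT, hgh, heE, he, hf, hg, hh, ha', hb', hEV, hab⟩ := D
  obtain ⟨hsub, hu⟩ := hP
  have haV : a ∈ V := hEV e heE a (by simp [he])
  have hbV : b ∈ V := hEV e heE b (by simp [he])
  have uniq : ∀ v ∈ V ∪ {a, b, a', b'}, ∀ x ∈ P, ∀ y ∈ P, v ∈ endpointsOf x →
      v ∈ endpointsOf y → x = y := fun v hv x hx y hy h1 h2 =>
    (hu v hv).unique ⟨hx, h1⟩ ⟨hy, h2⟩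
  have memP : ∀ x ∈ P, x ∈ E ∨ x = f ∨ x = g ∨ x = h := by
    intro x hx
    have := hsub hx
    rw [hT] at this
    rcases this with h1 | h1 | h1 | h1 | h1
    · exact Or.inl h1
    · exact Or.inl (h1 ▸ heE)
    · tauto
    · tauto
    · exact Or.inr (Or.inr (Or.inr h1))
  have fa : a' ∈ endpointsOf f := by simp [hf]
  have fb : b' ∈ endpointsOf f := by simp [hf]
  have ga : a ∈ endpointsOf g := by simp [hg]
  have ga' : a' ∈ endpointsOf g := by simp [hg]
  have hb1 : b ∈ endpointsOf h := by simp [hh]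
  have hb1' : b' ∈ endpointsOf h := by simp [hh]
  have aa : a' ≠ a := fun h => ha' (h ▸ haV)
  have ab : a' ≠ b := fun h => ha' (h ▸ hbV)
  have ba : b' ≠ a := fun h => hb' (h ▸ haV)
  have bb : b' ≠ b := fun h => hb' (h ▸ hbV)
  have hfg : f ≠ g := by
    intro h0; rw [h0, hg] at fb; simp at fb; rcases fb with h1 | h1
    · exact ba h1
    · exact hab h1.symm
  have hfh : f ≠ h := by
    intro h0; rw [h0, hh] at fa; simp at fa; rcases fa with h1 | h1
    · exact ab h1
    · exact hab h1
  by_cases hfP : f ∈ P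
  · left
    refine ⟨hfP, ?_, ?_⟩
    · intro x hx
      rcases memP x hx.1 with h1 | h1 | h1 | h1
      · exact h1
      · exact absurd h1 hx.2
      · exact absurd (uniq a' (by simp) f hfP g (h1 ▸ hx.1) fa ga') hfg
      · exact absurd (uniq b' (by simp) f hfP h (h1 ▸ hx.1) fb hb1') hfh
    · intro v hv
      obtain ⟨x, ⟨hx, hvx⟩, -⟩ := hu v (Or.inl hv)
      refine ⟨x, ⟨⟨hx, ?_⟩, hvx⟩, fun y hy => uniq v (Or.inl hv) y hy.1.1 x hx hy.2 hvx⟩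
      rintro rfl
      rw [hf] at hvx
      rcases hvx with h1 | h1
      · exact ha' (h1 ▸ hv)
      · exact hb' (h1 ▸ hv)
  · right
    have hgP : g ∈ P := by
      obtain ⟨x, ⟨hx, hvx⟩, -⟩ := hu a' (by simp)
      rcases memP x hx with h1 | h1 | h1 | h1
      · exact absurd (hEV x h1 _ hvx) ha'
      · exact absurd (h1 ▸ hx) hfP
      · exact h1 ▸ hx
      · rw [h1, hh] at hvx; simp at hvx; tauto
    have hhP : h ∈ P := by
      obtain ⟨x, ⟨hx, hvx⟩, -⟩ := hu b' (by simp)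
      rcases memP x hx with h1 | h1 | h1 | h1
      · exact absurd (hEV x h1 _ hvx) hb'
      · exact absurd (h1 ▸ hx) hfP
      · rw [h1, hg] at hvx; simp at hvx; exact absurd hvx (by rintro (h | h); exacts [ba h, hab h.symm])
      · exact h1 ▸ hx
    have heg : e ≠ g := fun h0 => ha' (hEV e heE _ (by rw [h0]; exact ga'))
    have ea : a ∈ endpointsOf e := by simp [he]
    refine ⟨hgP, hhP, fun h0 => heg (uniq a (by simp) e h0 g hgP ea ga), hfP, ?_, ?_⟩
    · rintro x (⟨h1, h2⟩ | h1)
      · rcases memP x h1 with h3 | h3 | h3 | h3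
        · exact h3
        · exact absurd (h3 ▸ h1) hfP
        · exact absurd (Or.inl h3) h2
        · exact absurd (Or.inr h3) h2
      · exact h1 ▸ heE
    · intro v hv
      by_cases hve : v ∈ endpointsOf e
      · refine ⟨e, ⟨Or.inr rfl, hve⟩, ?_⟩
        rintro y ⟨⟨h1, h2⟩ | h1, h3⟩
        · exfalso
          apply h2
          rw [he] at hve
          rcases hve with h4 | h4
          · subst h4; exact Or.inl (uniq _ (by simp) y h1 g hgP h3 ga)
          · subst h4; exact Or.inr (uniq _ (by simp) y h1 h hhP h3 hb1)
        · exact h1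
      · obtain ⟨x, ⟨hx, hvx⟩, -⟩ := hu v (Or.inl hv)
        have hn : v ≠ a ∧ v ≠ b := by rw [he] at hve; simpa using hve
        refine ⟨x, ⟨Or.inl ⟨hx, ?_⟩, hvx⟩, ?_⟩
        · rintro (h1 | h1)
          · rw [h1, hg] at hvx
            rcases hvx with h2 | h2
            · exact hn.1 h2
            · exact ha' (h2 ▸ hv)
          · rw [h1, hh] at hvx
            rcases hvx with h2 | h2
            · exact hn.2 h2
            · exact hb' (h2 ▸ hv)
        · rintro y ⟨⟨h1, h2⟩ | h1, h3⟩
          · exact uniq v (Or.inl hv) y h1 x hx h3 hvx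
          · exact absurd (h1 ▸ h3) hve

lemma corner_le {G : SnakeGraph} {n : ℕ} (h1n : 1 ≤ n) (hn : n ≤ G.d) :
    ∀ i, 1 ≤ i → i ≤ n →
    (G.corner i).1 ≤ (G.corner n).1 ∧ (G.corner i).2 ≤ (G.corner n).2 := by
  induction n, h1n using Nat.le_induction with
  | base => intro i h1 h2; obtain rfl : i = 1 := by omega
            simp
  | succ n h ih =>
    intro i h1 h2
    rcases Nat.lt_or_ge n i with h3 | h3
    · obtain rfl : i = n + 1 := by omega
      simp
    · have := ih (by omega) i h1 h3
      rcases G.corner_succ n h (by omega) with h4 | h4 <;> rw [h4] <;> simp <;> omega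

lemma VV_le {G : SnakeGraph} {n : ℕ} (h1n : 1 ≤ n) (hn : n ≤ G.d) {v} (hv : v ∈ VV G n) :
    v.1 ≤ (G.corner n).1 + 1 ∧ v.2 ≤ (G.corner n).2 + 1 := by
  rcases hv with hv | ⟨i, h1, h2, h3⟩
  · have := corner_le h1n hn 1 le_rfl h1n
    simp [westSide, endpointsOf] at hv
    rcases hv with rfl | rfl <;> (try simp only) <;> omega
  · have := corner_le h1n hn i h1 h2
    simp [tileCorners] at h3
    rcases h3 with rfl | rfl | rfl | rfl <;> (try simp only) <;> omega

lemma glue_west {G : SnakeGraph} {n : ℕ} (c : ℤ × ℤ) (hc : westSide c ∈ EE G n)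
    (hV : ∀ v ∈ VV G n, v.1 ≤ c.1) :
    Glue (EE G n) (VV G n) (tileSides c) (westSide c) (eastSide c) (southSide c) (northSide c)
      c (c.1, c.2 + 1) (c.1 + 1, c.2) (c.1 + 1, c.2 + 1) where
  hT := by ext x; simp [tileSides]; tauto
  hgh := by
    intro h
    have := congrArg (fun z : LatticeEdge => z.1.2) h
    simp [southSide, northSide] at this
  heE := hc
  he := by simp [endpointsOf, westSide]
  hf := by simp [endpointsOf, eastSide]
  hg := by simp [endpointsOf, southSide]
  hh := by simp [endpointsOf, northSide]
  ha' := fun h => by have := hV _ h; simp at this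
  hb' := fun h => by have := hV _ h; simp at this
  hEV := fun x hx v hv => ends_EE hx hv
  hab := by simp

lemma glue_south {G : SnakeGraph} {n : ℕ} (c : ℤ × ℤ) (hc : southSide c ∈ EE G n)
    (hV : ∀ v ∈ VV G n, v.2 ≤ c.2) :
    Glue (EE G n) (VV G n) (tileSides c) (southSide c) (northSide c) (westSide c) (eastSide c)
      c (c.1 + 1, c.2) (c.1, c.2 + 1) (c.1 + 1, c.2 + 1) where
  hT := by ext x; simp [tileSides]
  hgh := by
    intro h
    have := congrArg (fun z : LatticeEdge => z.1.1) h
    simp [westSide, eastSide] at this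
  heE := hc
  he := by simp [endpointsOf, southSide]
  hf := by simp [endpointsOf, northSide]
  hg := by simp [endpointsOf, westSide]
  hh := by simp [endpointsOf, eastSide]
  ha' := fun h => by have := hV _ h; simp at this
  hb' := fun h => by have := hV _ h; simp at this
  hEV := fun x hx v hv => ends_EE hx hv
  hab := by simp

lemma exists_glue {G : SnakeGraph} {n : ℕ} (hn : n + 1 ≤ G.d) :
    ∃ e f g h a b a' b', Glue (EE G n) (VV G n) (G.tile (n + 1)) e f g h a b a' b' ∧
      tileCorners (G.corner (n + 1)) = {a, b, a', b'} := by
  rcases Nat.eq_zero_or_pos n with rfl | h0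
  · refine ⟨_, _, _, _, _, _, _, _, glue_west _ (Or.inl rfl) ?_, ?_⟩
    · rintro v (hv | ⟨i, h1, h2, -⟩)
      · simp [westSide, endpointsOf] at hv
        rcases hv with rfl | rfl <;> simp
      · omega
    · ext x; simp [tileCorners]; tauto
  · rcases G.corner_succ n h0 (by omega) with h4 | h4
    · refine ⟨_, _, _, _, _, _, _, _, glue_west _ (Or.inr ⟨n, h0, le_rfl, ?_⟩) ?_, ?_⟩
      · rw [h4]; simp [SnakeGraph.tile, tileSides, westSide, eastSide]
      · intro v hv; rw [h4]; exact (VV_le h0 (by omega) hv).1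
      · ext x; simp [tileCorners]; tauto
    · refine ⟨_, _, _, _, _, _, _, _, glue_south _ (Or.inr ⟨n, h0, le_rfl, ?_⟩) ?_, ?_⟩
      · rw [h4]; simp [SnakeGraph.tile, tileSides, southSide, northSide]
      · intro v hv; rw [h4]; exact (VV_le h0 (by omega) hv).2
      · ext x; simp [tileCorners]

lemma EE_succ (G : SnakeGraph) (n : ℕ) : EE G (n + 1) = EE G n ∪ G.tile (n + 1) := by
  ext x
  constructor
  · rintro (h | ⟨i, h1, h2, h3⟩)
    · exact Or.inl (Or.inl h)
    · rcases Nat.lt_or_ge n i with h4 | h4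
      · obtain rfl : i = n + 1 := by omega
        exact Or.inr h3
      · exact Or.inl (Or.inr ⟨i, h1, h4, h3⟩)
  · rintro ((h | ⟨i, h1, h2, h3⟩) | h)
    · exact Or.inl h
    · exact Or.inr ⟨i, h1, by omega, h3⟩
    · exact Or.inr ⟨n + 1, by omega, le_rfl, h⟩

lemma VV_succ (G : SnakeGraph) (n : ℕ) :
    VV G (n + 1) = VV G n ∪ tileCorners (G.corner (n + 1)) := by
  ext x
  constructor
  · rintro (h | ⟨i, h1, h2, h3⟩)
    · exact Or.inl (Or.inl h)
    · rcases Nat.lt_or_ge n i with h4 | h4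
      · obtain rfl : i = n + 1 := by omega
        exact Or.inr h3
      · exact Or.inl (Or.inr ⟨i, h1, h4, h3⟩)
  · rintro ((h | ⟨i, h1, h2, h3⟩) | h)
    · exact Or.inl h
    · exact Or.inr ⟨i, h1, by omega, h3⟩
    · exact Or.inr ⟨n + 1, by omega, le_rfl, h⟩

lemma connected (G : SnakeGraph) (n : ℕ) (hn : n ≤ G.d) : ∀ P Q : Set LatticeEdge,
    PM (EE G n) (VV G n) P → PM (EE G n) (VV G n) Q →
    Relation.ReflTransGen (Step G n) P Q := by
  induction n with
  | zero =>
    have key : ∀ P, PM (EE G 0) (VV G 0) P → P = {westSide (G.corner 1)} := by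
      rintro P ⟨h1, h2⟩
      have h3 : ∀ x ∈ P, x = westSide (G.corner 1) := by
        intro x hx
        rcases h1 hx with h | ⟨i, h3, h4, -⟩
        · exact h
        · omega
      obtain ⟨x, ⟨hx, -⟩, -⟩ := h2 (G.corner 1) (Or.inl (by simp [westSide, endpointsOf]))
      ext y
      exact ⟨h3 y, fun hy => by rw [Set.mem_singleton_iff.1 hy, ← h3 x hx]; exact hx⟩
    intro P Q hP hQ
    rw [key P hP, key Q hQ]
  | succ n ih =>
    obtain ⟨e, f, g, h, a, b, a', b', D, hc⟩ := exists_glue hn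
    have hfE : f ∉ EE G n := fun h0 => D.ha' (D.hEV f h0 a' (by simp [D.hf]))
    have hgE : g ∉ EE G n := fun h0 => D.ha' (D.hEV g h0 a' (by simp [D.hg]))
    have hhE : h ∉ EE G n := fun h0 => D.hb' (D.hEV h h0 b' (by simp [D.hh]))
    have heE := D.heE
    rw [EE_succ, VV_succ, hc]
    -- every matching reaches one containing `f`
    have reach : ∀ P, PM (EE G n ∪ G.tile (n + 1)) (VV G n ∪ {a, b, a', b'}) P →
        ∃ P₀, PM (EE G n) (VV G n) P₀ ∧
          Relation.ReflTransGen (Step G (n + 1)) P (P₀ ∪ {f}) := by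
      intro P hP
      rcases glue_cases D hP with ⟨h1, h2⟩ | ⟨h1, h2, h3, h4, h5⟩
      · refine ⟨_, h2, ?_⟩
        rw [Set.sdiff_union_of_subset (by simpa using h1)]
      · refine ⟨_, h5, .single ⟨n + 1, by omega, le_rfl, ?_, ?_⟩⟩
        · have : P ∩ G.tile (n + 1) = {g, h} := by
            rw [D.hT]; ext x; simp only [Set.mem_inter_iff, Set.mem_insert_iff,
              Set.mem_singleton_iff]
            constructor
            · rintro ⟨hx, rfl | rfl | h | h⟩ <;> tauto
            · rintro (rfl | rfl) <;> tauto
          rw [this, Set.ncard_pair D.hgh]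
        · rw [SnakeGraph.twist, D.hT]
          ext x
          simp only [Set.mem_union, Set.mem_sdiff, Set.mem_insert_iff, Set.mem_singleton_iff]
          by_cases x1 : x = e
          · subst x1; tauto
          by_cases x2 : x = f
          · subst x2; tauto
          by_cases x3 : x = g
          · subst x3; tauto
          by_cases x4 : x = h
          · subst x4; tauto
          tauto
    have lift : ∀ P Q, Relation.ReflTransGen (Step G n) P Q →
        Relation.ReflTransGen (Step G (n + 1)) (P ∪ {f}) (Q ∪ {f}) := by
      intro P Q hPQ
      refine Relation.ReflTransGen.lift (fun P : Set LatticeEdge => P ∪ {f}) ?_ _ _ hPQ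
      rintro A B ⟨i, h1, h2, h3, rfl⟩
      have hfi : f ∉ G.tile i := fun h0 => hfE (Or.inr ⟨i, h1, h2, h0⟩)
      refine ⟨i, h1, by omega, ?_, ?_⟩
      · have : (A ∪ {f}) ∩ G.tile i = A ∩ G.tile i := by
          ext x; by_cases x2 : x = f
          · subst x2; simp [hfi]
          · simp [x2]
        simp only [this, h3]
      · ext x; by_cases x2 : x = f
        · subst x2; simp [SnakeGraph.twist, hfi]
        · simp [SnakeGraph.twist, x2]
    intro P Q hP hQ
    obtain ⟨P₀, hP₀, rP⟩ := reach P hP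
    obtain ⟨Q₀, hQ₀, rQ⟩ := reach Q hQ
    have hs : Std.Symm (Step G (n + 1)) := ⟨fun _ _ h => step_symm h⟩
    exact (rP.trans (lift _ _ (ih (by omega) _ _ hP₀ hQ₀))).trans
      (Relation.ReflTransGen.stdSymm.symm _ _ rQ)

lemma to_seq {G : SnakeGraph} {P Q : Set LatticeEdge}
    (h : Relation.ReflTransGen (Step G G.d) P Q) :
    ∃ (r : ℕ) (idx : ℕ → ℕ) (R : ℕ → Set LatticeEdge),
      R 0 = P ∧ R r = Q ∧
      ∀ t, t < r → G.CanTwist (R t) (idx t) ∧ R (t + 1) = G.twist (idx t) (R t) := by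
  induction h using Relation.ReflTransGen.head_induction_on with
  | refl => exact ⟨0, fun _ => 0, fun _ => Q, rfl, rfl, fun t ht => by omega⟩
  | @head A B hs _ ih =>
    obtain ⟨r, idx, R, h0, hr, ht⟩ := ih
    obtain ⟨i, h1, h2, h3, h4⟩ := hs
    refine ⟨r + 1, fun t => Nat.casesOn t i idx, fun t => Nat.casesOn t A R, rfl, hr, ?_⟩
    rintro (_ | t) htr
    · exact ⟨⟨h1, h2, h3⟩, h0.trans h4⟩
    · exact ht t (by omega)

lemma PM_of {G : SnakeGraph} {P : Set LatticeEdge} (hP : G.IsPerfectMatching P) :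
    PM (EE G G.d) (VV G G.d) P := by
  obtain ⟨h1, h2⟩ := hP
  constructor
  · intro x hx
    have := h1 hx
    simp only [SnakeGraph.edges, Set.mem_iUnion, Set.mem_Icc] at this
    obtain ⟨i, ⟨h3, h4⟩, h5⟩ := this
    exact Or.inr ⟨i, h3, h4, h5⟩
  · intro v hv
    apply h2
    simp only [SnakeGraph.vertices, Set.mem_iUnion, Set.mem_Icc]
    rcases hv with hv | ⟨i, h3, h4, h5⟩
    · exact ⟨1, ⟨le_rfl, G.one_le_d⟩, ends_tile (by simp [tileSides]) hv⟩
    · exact ⟨i, ⟨h3, h4⟩, h5⟩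

end TwistAux

/-- Any two perfect matchings of a snake graph are related by a finite
sequence of twists. -/
theorem twist_transitive
    (G : SnakeGraph) (P Q : Set LatticeEdge)
    (hP : G.IsPerfectMatching P) (hQ : G.IsPerfectMatching Q) :
    ∃ (r : ℕ) (idx : ℕ → ℕ) (R : ℕ → Set LatticeEdge),
      R 0 = P ∧ R r = Q ∧
      ∀ t, t < r → G.CanTwist (R t) (idx t) ∧ R (t + 1) = G.twist (idx t) (R t) := by
  exact TwistAux.to_seq (TwistAux.connected G G.d le_rfl P Q (TwistAux.PM_of hP) (TwistAux.PM_of hQ))
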